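/- As n → ∞, F₁₁₁₁(n) ∼ (n!/4) · e^{-(log 2)²/2} · (log 2)^{-(2n+2)}, i.e. the ratio of F₁₁₁₁(n) to (n!/4) · e^{-(log 2)²/2} / (log 2)^{2n+2} tends to 1. -/

import Mathlib

open scoped BigOperators

/-- A zero-one matrix (entries in `Bool`) with no zero rows and no zero columns. -/
def IsIncidence {k l : ℕ} (M : Matrix (Fin k) (Fin l) Bool) : Prop :=
  (∀ i, ∃ j, M i j = true) ∧ (∀ j, ∃ i, M i j = true)

/-- The number of entries equal to one in a zero-one matrix. -/
def numOnes {k l : ℕ} (M : Matrix (Fin k) (Fin l) Bool) : ℕ :=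
  (Finset.univ.filter fun p : Fin k × Fin l => M p.1 p.2 = true).card

/-- `F₁₁₁₁ n`: the number of incidence matrices (of any size) with exactly `n` ones. -/
noncomputable def F1111 (n : ℕ) : ℕ :=
  Nat.card {A : Σ k l : ℕ, Matrix (Fin k) (Fin l) Bool //
    IsIncidence A.2.2 ∧ numOnes A.2.2 = n}

noncomputable def mIJ (i j n : ℕ) : ℕ :=
  Nat.card {M : Matrix (Fin i) (Fin j) Bool // IsIncidence M ∧ numOnes M = n}

/-- total preorders on `Fin n` -/
noncomputable def numPreorders (n : ℕ) : ℕ :=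
  Nat.card {R : Fin n → Fin n → Prop //
    (∀ x, R x x) ∧ (∀ x y z, R x y → R y z → R x z) ∧ (∀ x y, R x y ∨ x = y ∨ R y x)}

noncomputable def numPreordersWithBlocks (n k : ℕ) : ℕ :=
  Nat.card {R : Fin n → Fin n → Prop //
    ((∀ x, R x x) ∧ (∀ x y z, R x y → R y z → R x z) ∧ (∀ x y, R x y ∨ x = y ∨ R y x)) ∧
    Nat.card (Quot fun x y => R x y ∧ R y x) = k}

noncomputable def S11 (n : ℕ) : ℕ :=
  Nat.card {A : Σ k : ℕ, Matrix (Fin k) (Fin k) Bool //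
    (∀ i j, A.2 i j = A.2 j i) ∧ IsIncidence A.2 ∧ numOnes A.2 = n}

def trSigma : (Σ k l : ℕ, Matrix (Fin k) (Fin l) Bool) → (Σ k l : ℕ, Matrix (Fin k) (Fin l) Bool) :=
  fun A => ⟨A.2.1, A.1, A.2.2.transpose⟩

noncomputable def Phi11 (n : ℕ) : ℕ :=
  Nat.card (Quot fun x y : {A : Σ k l : ℕ, Matrix (Fin k) (Fin l) Bool //
    IsIncidence A.2.2 ∧ numOnes A.2.2 = n} => trSigma x.1 = y.1)

noncomputable def F1011 (n : ℕ) : ℕ :=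
  Nat.card {A : Σ k l : ℕ, Matrix (Fin k) (Fin l) Bool //
    IsIncidence A.2.2 ∧ numOnes A.2.2 = n ∧
    ∀ i i' : Fin A.1, (∀ j, A.2.2 i j = A.2.2 i' j) → i = i'}

noncomputable def F0001 (n : ℕ) : ℕ :=
  Nat.card (Quot fun x y : {A : Σ k l : ℕ, Matrix (Fin k) (Fin l) Bool //
      IsIncidence A.2.2 ∧ numOnes A.2.2 = n ∧
      ∀ i i' : Fin A.1, (∀ j, A.2.2 i j = A.2.2 i' j) → i = i'} =>
    ∃ σ : Equiv.Perm (Fin x.1.1), ∃ τ : Equiv.Perm (Fin x.1.2.1),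
      y.1 = ⟨x.1.1, x.1.2.1, Matrix.of fun i j => x.1.2.2 (σ i) (τ j)⟩)

noncomputable def numInvolutions (n : ℕ) : ℕ :=
  Nat.card {σ : Equiv.Perm (Fin n) // σ * σ = 1}

/-- number of cycles of a permutation, counting fixed points as cycles -/
def numCycles {n : ℕ} (σ : Equiv.Perm (Fin n)) : ℕ :=
  Multiset.card σ.cycleType + (n - σ.support.card)

/-- unsigned Stirling number of the first kind: permutations of `n` with `k` cycles -/
noncomputable def stirling1Unsigned (n k : ℕ) : ℕ :=
  Nat.card {σ : Equiv.Perm (Fin n) // numCycles σ = k}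

/-- Stirling number of the second kind: partitions of an `n`-set into `k` blocks -/
noncomputable def stirling2 (n k : ℕ) : ℕ :=
  Nat.card {c : Setoid (Fin n) // Nat.card (Quotient c) = k}

noncomputable def sSym (k n : ℕ) : ℕ :=
  Nat.card {M : Matrix (Fin k) (Fin k) Bool // (∀ a b, M a b = M b a) ∧ numOnes M = n}

noncomputable def muSym (i n : ℕ) : ℕ :=
  Nat.card {M : Matrix (Fin i) (Fin i) Bool //
    (∀ a b, M a b = M b a) ∧ IsIncidence M ∧ numOnes M = n}

/-- The coefficient of `x ^ (n - j)` in the falling factorial `x (x - 1) ⋯ (x - n + 1)`, up to the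
sign `(-1) ^ j`. -/
def fallingCoeff : ℕ → ℕ → ℕ
  | _, 0 => 1
  | 0, _ + 1 => 0
  | n + 1, j + 1 => fallingCoeff n (j + 1) + n * fallingCoeff n j

lemma fallingCoeff_zero_right (n : ℕ) : fallingCoeff n 0 = 1 := by
  cases n <;> rfl

lemma fallingCoeff_eq_zero {n j : ℕ} (h : n < j) : fallingCoeff n j = 0 := by
  induction n generalizing j with
  | zero => obtain ⟨j, rfl⟩ := Nat.exists_eq_succ_of_ne_zero h.ne'; rfl
  | succ n ih =>
    obtain ⟨j, rfl⟩ := Nat.exists_eq_succ_of_ne_zero (by lia : j ≠ 0)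
    rw [fallingCoeff, ih (by lia), ih (by lia), mul_zero, add_zero]

lemma descFactorial_eq_sum_fallingCoeff (m n : ℕ) :
    (m.descFactorial n : ℝ) =
      ∑ j ∈ Finset.range (n + 1), (-1) ^ j * (fallingCoeff n j : ℝ) * (m : ℝ) ^ (n - j) := by
  induction n with
  | zero => simp [fallingCoeff]
  | succ n ih =>
    have hstep : ((m.descFactorial (n + 1) : ℕ) : ℝ) = (m - n) * (m.descFactorial n : ℝ) := by
      rw [Nat.descFactorial_succ]
      rcases le_or_gt n m with h | h
      · push_cast [Nat.cast_sub h]; rfl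
      · simp [Nat.descFactorial_of_lt h]
    have hshift : (m : ℝ) * (m.descFactorial n : ℝ) = (m : ℝ) ^ (n + 1) +
        ∑ j ∈ Finset.range (n + 1),
          (-1) ^ (j + 1) * (fallingCoeff n (j + 1) : ℝ) * (m : ℝ) ^ (n - j) := by
      rw [ih, Finset.sum_range_succ', Finset.sum_range_succ _ n,
        fallingCoeff_eq_zero (Nat.lt_succ_self n), mul_add, Finset.mul_sum]
      have : ∀ j ∈ Finset.range n,
          (m : ℝ) * ((-1) ^ (j + 1) * (fallingCoeff n (j + 1) : ℝ) * (m : ℝ) ^ (n - (j + 1))) =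
            (-1) ^ (j + 1) * (fallingCoeff n (j + 1) : ℝ) * (m : ℝ) ^ (n - j) := by
        intro j hj
        have hj' : n - j = n - (j + 1) + 1 := by
          have := Finset.mem_range.mp hj
          lia
        rw [hj', pow_succ]
        ring
      rw [Finset.sum_congr rfl this, fallingCoeff_zero_right]
      simp
      ring
    rw [hstep, sub_mul, hshift, ih, Finset.sum_range_succ' _ (n + 1), fallingCoeff_zero_right,
      Finset.mul_sum, add_sub_assoc, ← Finset.sum_sub_distrib, add_comm]
    congr 1
    · refine Finset.sum_congr rfl fun j _ => ?_
      rw [fallingCoeff, Nat.add_sub_add_right]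
      push_cast
      ring
    · simp

lemma fallingCoeff_le (n j : ℕ) :
    (fallingCoeff n j : ℝ) ≤ (n : ℝ) ^ (2 * j) / (2 ^ j * j.factorial) := by
  induction n generalizing j with
  | zero => cases j <;> simp [fallingCoeff]
  | succ n ih =>
    cases j with
    | zero => simp [fallingCoeff]
    | succ j =>
      have hb : (n : ℝ) ^ (2 * (j + 1)) + (2 * (j + 1)) * n ^ (2 * j + 1) ≤
          ((n : ℝ) + 1) ^ (2 * (j + 1)) := by
        have := pow_add_mul_le_add_pow (a := (n : ℝ)) (b := 1) (by positivity) (by positivity)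
          (2 * (j + 1))
        simpa [mul_add] using this
      have h1 := ih (j + 1)
      have h2 := mul_le_mul_of_nonneg_left (ih j) (Nat.cast_nonneg (α := ℝ) n)
      rw [fallingCoeff]
      push_cast
      refine (add_le_add h1 h2).trans ?_
      rw [show (2 : ℝ) ^ (j + 1) * ((j + 1).factorial : ℝ) =
        2 * (j + 1) * (2 ^ j * (j.factorial : ℝ)) by rw [Nat.factorial_succ]; push_cast; ring]
      calc _ = ((n : ℝ) ^ (2 * (j + 1)) + (2 * (j + 1)) * n ^ (2 * j + 1)) /
            (2 * (j + 1) * (2 ^ j * (j.factorial : ℝ))) := by field_simp; ring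
        _ ≤ _ := by gcongr

lemma le_fallingCoeff (n j : ℕ) :
    ((n - j : ℕ) : ℝ) ^ (2 * j) / (2 ^ j * j.factorial) ≤ fallingCoeff n j := by
  induction n generalizing j with
  | zero => cases j <;> simp [fallingCoeff]
  | succ n ih =>
    cases j with
    | zero => simp [fallingCoeff]
    | succ j =>
      rcases le_or_gt n j with hj | hj
      · have : n + 1 - (j + 1) = 0 := by lia
        simp [this]
      · obtain ⟨x, rfl⟩ := Nat.exists_eq_add_of_lt hj
        have h1 := ih (j + 1)
        have h2 := ih j
        rw [show j + x + 1 - (j + 1) = x by lia] at h1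
        rw [show j + x + 1 - j = x + 1 by lia] at h2
        rw [show j + x + 1 + 1 - (j + 1) = x + 1 by lia, fallingCoeff]
        have h3 : ((x + 1 : ℕ) : ℝ) * (((x + 1 : ℕ) : ℝ) ^ (2 * j) / (2 ^ j * j.factorial)) ≤
            ((j + x + 1 : ℕ) : ℝ) * fallingCoeff (j + x + 1) j := by
          gcongr
          lia
        have hb : ((x : ℝ) + 1) ^ (2 * (j + 1)) ≤
            (x : ℝ) ^ (2 * (j + 1)) + (2 * (j + 1)) * ((x : ℝ) + 1) ^ (2 * j + 1) := by
          have := pow_add_mul_le_add_pow (a := (x : ℝ) + 1) (b := -1) (by positivity)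
            (by linarith [Nat.cast_nonneg (α := ℝ) x]) (2 * (j + 1))
          have hx : (x : ℝ) + 1 + -1 = x := by ring
          rw [hx, show 2 * (j + 1) - 1 = 2 * j + 1 by lia] at this
          push_cast at this
          linarith
        push_cast at h1 h3 ⊢
        refine le_trans ?_ (add_le_add h1 h3)
        rw [show (2 : ℝ) ^ (j + 1) * ((j + 1).factorial : ℝ) =
          2 * (j + 1) * (2 ^ j * (j.factorial : ℝ)) by rw [Nat.factorial_succ]; push_cast; ring]
        calc _ ≤ ((x : ℝ) ^ (2 * (j + 1)) + (2 * (j + 1)) * ((x : ℝ) + 1) ^ (2 * j + 1)) /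
              (2 * (j + 1) * (2 ^ j * (j.factorial : ℝ))) := by gcongr
          _ = _ := by field_simp; ring

lemma pow_le_exp_mul_descFactorial {n j : ℕ} (h : j ≤ n) :
    (n : ℝ) ^ j ≤ Real.exp j * n.descFactorial j := by
  have h1 : (j : ℝ) ^ j ≤ Real.exp j * j.factorial := by
    have := Real.pow_div_factorial_le_exp (j : ℝ) (Nat.cast_nonneg _) j
    rwa [div_le_iff₀ (by positivity)] at this
  have h2 : n ^ j * j.factorial ≤ j ^ j * n.descFactorial j := by
    rw [← Nat.descFactorial_self, Nat.descFactorial_eq_prod_range, Nat.descFactorial_eq_prod_range,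
      ← Finset.card_range j, ← Finset.prod_const, ← Finset.prod_const, Finset.card_range,
      ← Finset.prod_mul_distrib, ← Finset.prod_mul_distrib]
    refine Finset.prod_le_prod' fun i hi => ?_
    rw [Nat.mul_sub, Nat.mul_sub, mul_comm j n]
    exact Nat.sub_le_sub_left (Nat.mul_le_mul_right i h) _
  have h2' : (n : ℝ) ^ j * j.factorial ≤ (j : ℝ) ^ j * n.descFactorial j := by exact_mod_cast h2
  have hpos : (0 : ℝ) < j.factorial := by positivity
  refine le_of_mul_le_mul_right ?_ hpos
  calc _ ≤ (j : ℝ) ^ j * n.descFactorial j := h2'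
    _ ≤ Real.exp j * j.factorial * n.descFactorial j := by gcongr
    _ = _ := by ring

lemma tendsto_fallingCoeff_div_descFactorial_sq (j : ℕ) :
    Filter.Tendsto (fun n : ℕ => (fallingCoeff n j : ℝ) / (n.descFactorial j : ℝ) ^ 2)
      Filter.atTop (nhds (1 / (2 ^ j * j.factorial))) := by
  have hratio : Filter.Tendsto (fun n : ℕ => ((n - j : ℕ) : ℝ) / n) Filter.atTop (nhds 1) := by
    have h0 := tendsto_const_div_atTop_nhds_zero_nat (j : ℝ)
    have h1 := (tendsto_const_nhds (x := (1 : ℝ))).sub h0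
    rw [sub_zero] at h1
    refine h1.congr' ?_
    filter_upwards [Filter.eventually_ge_atTop (j + 1)] with n hn
    have : (n : ℝ) ≠ 0 := by norm_cast; lia
    rw [Nat.cast_sub (by lia)]
    field_simp
  have hcoeff : Filter.Tendsto (fun n : ℕ => (fallingCoeff n j : ℝ) / (n : ℝ) ^ (2 * j))
      Filter.atTop (nhds (1 / (2 ^ j * j.factorial))) := by
    have hlow := (hratio.pow (2 * j)).mul_const (1 / ((2 : ℝ) ^ j * j.factorial))
    rw [one_pow, one_mul] at hlow
    refine tendsto_of_tendsto_of_tendsto_of_le_of_le' hlow tendsto_const_nhds ?_ ?_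
    all_goals
      filter_upwards [Filter.eventually_gt_atTop 0] with n hn
      have hn' : (0 : ℝ) < n := by exact_mod_cast hn
    · rw [le_div_iff₀ (by positivity)]
      refine le_trans (le_of_eq ?_) (le_fallingCoeff n j)
      rw [div_pow]
      field_simp
    · rw [div_le_iff₀ (by positivity)]
      exact (fallingCoeff_le n j).trans_eq (by ring)
  have hdesc : Filter.Tendsto (fun n : ℕ => (n : ℝ) ^ j / (n.descFactorial j : ℝ))
      Filter.atTop (nhds 1) := by
    have hE := (Asymptotics.isEquivalent_iff_tendsto_one ?_).mp (isEquivalent_descFactorial j).symm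
    · exact hE
    · filter_upwards [Filter.eventually_ge_atTop j] with n hn
      exact_mod_cast (Nat.descFactorial_pos.mpr hn).ne'
  have := hcoeff.mul (hdesc.pow 2)
  rw [one_pow, mul_one] at this
  refine this.congr' ?_
  filter_upwards [Filter.eventually_gt_atTop 0] with n hn
  have hn' : (n : ℝ) ≠ 0 := by exact_mod_cast hn.ne'
  rw [div_pow, ← pow_mul, mul_comm j 2]
  field_simp

open MeasureTheory in
lemma abs_sub_integral_unit_le {f f' g : ℝ → ℝ} (hf : ∀ x, HasDerivAt f (f' x) x)
    (hf' : Continuous f') (hg : Continuous g) (a : ℝ) (hfg : ∀ x, a ≤ x → |f' x| ≤ g x) :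
    |f (a + 1) - ∫ x in a..(a + 1), f x| ≤ ∫ x in a..(a + 1), g x := by
  have hfc : Continuous f := continuous_iff_continuousAt.mpr fun x => (hf x).continuousAt
  have hpoint : ∀ x ∈ Set.uIoc a (a + 1), ‖f (a + 1) - f x‖ ≤ ∫ x in a..(a + 1), g x := by
    intro x hx
    rw [Set.uIoc_of_le (by linarith)] at hx
    rw [← intervalIntegral.integral_eq_sub_of_hasDerivAt (fun y _ => hf y)
      (hf'.intervalIntegrable _ _)]
    refine (intervalIntegral.norm_integral_le_of_norm_le hx.2
      (ae_of_all _ fun y hy => hfg y (hx.1.le.trans hy.1.le)) (hg.intervalIntegrable _ _)).trans ?_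
    refine intervalIntegral.integral_mono_interval hx.1.le hx.2 le_rfl ?_
      (hg.intervalIntegrable _ _)
    filter_upwards [ae_restrict_mem measurableSet_Ioc] with y hy
    exact (abs_nonneg _).trans (hfg y hy.1.le)
  have := intervalIntegral.norm_integral_le_of_norm_le_const hpoint
  rw [intervalIntegral.integral_sub (continuous_const.intervalIntegrable _ _)
    (hfc.intervalIntegrable _ _)] at this
  simpa using this

lemma abs_sum_sub_integral_le {f f' g : ℝ → ℝ} (hf : ∀ x, HasDerivAt f (f' x) x)
    (hf' : Continuous f') (hg : Continuous g) (hfg : ∀ x, 0 ≤ x → |f' x| ≤ g x) (N : ℕ) :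
    |∑ i ∈ Finset.range N, f (i + 1) - ∫ x in (0 : ℝ)..N, f x| ≤ ∫ x in (0 : ℝ)..N, g x := by
  have hfc : Continuous f := continuous_iff_continuousAt.mpr fun x => (hf x).continuousAt
  have hsplit : ∀ u : ℝ → ℝ, Continuous u →
      ∫ x in (0 : ℝ)..N, u x = ∑ i ∈ Finset.range N, ∫ x in (i : ℝ)..(i + 1), u x := by
    intro u hu
    have := intervalIntegral.sum_integral_adjacent_intervals (μ := MeasureTheory.volume)
      (f := u) (a := fun i : ℕ => (i : ℝ)) (n := N) fun _ _ => hu.intervalIntegrable _ _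
    simpa using this.symm
  rw [hsplit f hfc, hsplit g hg, ← Finset.sum_sub_distrib]
  exact (Finset.abs_sum_le_sum_abs _ _).trans (Finset.sum_le_sum fun i _ =>
    abs_sub_integral_unit_le hf hf' hg i fun x hx => hfg x ((Nat.cast_nonneg i).trans hx))

open MeasureTheory in
lemma integrableOn_pow_mul_exp_neg {r : ℝ} (hr : 0 < r) (p : ℕ) :
    IntegrableOn (fun x : ℝ => x ^ p * Real.exp (-(r * x))) (Set.Ioi 0) := by
  have := integrableOn_rpow_mul_exp_neg_mul_rpow (p := 1) (s := p) (b := r)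
    (by linarith [Nat.cast_nonneg (α := ℝ) p]) one_pos hr
  simpa using this

open MeasureTheory in
lemma integral_pow_mul_exp_neg {r : ℝ} (hr : 0 < r) (p : ℕ) :
    ∫ x in Set.Ioi (0 : ℝ), x ^ p * Real.exp (-(r * x)) = p.factorial / r ^ (p + 1) := by
  have := Real.integral_rpow_mul_exp_neg_mul_Ioi (a := p + 1) (r := r) (by positivity) hr
  rw [Real.Gamma_nat_eq_factorial, add_sub_cancel_right] at this
  simp only [Real.rpow_natCast] at this
  rw [this, ← Nat.cast_succ, Real.rpow_natCast, one_div, inv_pow]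
  field_simp

/-- The series `∑ i ^ k / 2 ^ (i + 1)`, whose value is the number of total preorders of a
`k`-element set. -/
noncomputable def preorderSeries (k : ℕ) : ℝ := ∑' i : ℕ, (i : ℝ) ^ k * (1 / 2) ^ (i + 1)

lemma hasSum_preorderSeries (k : ℕ) :
    HasSum (fun i : ℕ => (i : ℝ) ^ k * (1 / 2) ^ (i + 1)) (preorderSeries k) := by
  refine Summable.hasSum ?_
  have := (summable_pow_mul_geometric_of_norm_lt_one k (r := (1 / 2 : ℝ)) (by norm_num)).mul_right
    (1 / 2 : ℝ)
  refine this.congr fun i => ?_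
  ring

open MeasureTheory Filter in
lemma abs_two_mul_preorderSeries_sub_le (p : ℕ) :
    |2 * preorderSeries (p + 1) - (p + 1).factorial / Real.log 2 ^ (p + 2)| ≤
      p.factorial / Real.log 2 ^ (p + 1) * √(p + 1) := by
  set L := Real.log 2 with hL
  have hLpos : 0 < L := Real.log_pos (by norm_num)
  set s := √((p : ℝ) + 1) with hs
  have hspos : 0 < s := Real.sqrt_pos.mpr (by positivity)
  have hssq : s ^ 2 = p + 1 := Real.sq_sqrt (by positivity)
  set f : ℝ → ℝ := fun x => x ^ (p + 1) * Real.exp (-(L * x)) with hfdef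
  set f' : ℝ → ℝ := fun x => x ^ p * Real.exp (-(L * x)) * (p + 1 - L * x) with hf'def
  set g : ℝ → ℝ := fun x => (s / 2 + (p + 1) ^ 2 / (2 * s)) * (x ^ p * Real.exp (-(L * x))) -
    (p + 1) * L / s * (x ^ (p + 1) * Real.exp (-(L * x))) +
    L ^ 2 / (2 * s) * (x ^ (p + 2) * Real.exp (-(L * x))) with hgdef
  have hf : ∀ x, HasDerivAt f (f' x) x := by
    intro x
    have h1 : HasDerivAt (fun x : ℝ => Real.exp (-(L * x))) (Real.exp (-(L * x)) * -(L * 1)) x :=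
      ((hasDerivAt_id x).const_mul L).neg.exp
    have h2 := (hasDerivAt_pow (p + 1) x).mul h1
    refine h2.congr_deriv ?_
    simp only [hf'def, Nat.add_sub_cancel]
    push_cast
    ring
  have hf'c : Continuous f' := by fun_prop
  have hgc : Continuous g := by fun_prop
  have hfg : ∀ x, 0 ≤ x → |f' x| ≤ g x := by
    intro x hx
    have hw : 0 ≤ x ^ p * Real.exp (-(L * x)) := by positivity
    have hamgm : |(p : ℝ) + 1 - L * x| ≤ s / 2 + (p + 1 - L * x) ^ 2 / (2 * s) := by
      have h := sq_nonneg (|(p : ℝ) + 1 - L * x| - s)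
      rw [← sq_abs ((p : ℝ) + 1 - L * x), div_add_div _ _ (by norm_num) (by positivity),
        le_div_iff₀ (by positivity)]
      nlinarith
    rw [hf'def]
    simp only [abs_mul _ ((p : ℝ) + 1 - L * x), abs_of_nonneg hw]
    refine (mul_le_mul_of_nonneg_left hamgm hw).trans_eq ?_
    rw [hgdef]
    field_simp
    ring
  have hI := integrableOn_pow_mul_exp_neg hLpos
  have hgI : IntegrableOn g (Set.Ioi 0) :=
    (((hI p).const_mul _).sub ((hI (p + 1)).const_mul _)).add ((hI (p + 2)).const_mul _)
  have hgint : ∫ x in Set.Ioi (0 : ℝ), g x = p.factorial / L ^ (p + 1) * s := by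
    have hsub : IntegrableOn (fun x : ℝ =>
        (s / 2 + (p + 1) ^ 2 / (2 * s)) * (x ^ p * Real.exp (-(L * x))) -
          (p + 1) * L / s * (x ^ (p + 1) * Real.exp (-(L * x)))) (Set.Ioi 0) :=
      ((hI p).const_mul _).sub ((hI (p + 1)).const_mul _)
    simp only [hgdef]
    rw [integral_add hsub ((hI (p + 2)).const_mul _),
      integral_sub ((hI p).const_mul _) ((hI (p + 1)).const_mul _),
      integral_const_mul, integral_const_mul, integral_const_mul,
      integral_pow_mul_exp_neg hLpos, integral_pow_mul_exp_neg hLpos,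
      integral_pow_mul_exp_neg hLpos, Nat.factorial_succ (p + 1), Nat.factorial_succ p]
    push_cast
    have hp : (p : ℝ) = s ^ 2 - 1 := by linarith
    rw [hp]
    field_simp
    ring
  have hsum : Tendsto (fun N : ℕ => ∑ i ∈ Finset.range N, f (i + 1)) atTop
      (nhds (2 * preorderSeries (p + 1))) := by
    have h := (((hasSum_nat_add_iff' 1).mpr (hasSum_preorderSeries (p + 1))).mul_left 2)
    simp only [Finset.range_one, Finset.sum_singleton, Nat.cast_zero, ne_eq, Nat.succ_ne_zero,
      not_false_eq_true, zero_pow, zero_mul, sub_zero] at h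
    convert! h.tendsto_sum_nat using 3 with N i
    have hexp : Real.exp (-(L * (i + 1))) = (1 / 2) ^ (i + 1) := by
      rw [show -(L * ((i : ℝ) + 1)) = ((i + 1 : ℕ) : ℝ) * -L by push_cast; ring, Real.exp_nat_mul,
        Real.exp_neg, hL, Real.exp_log (by norm_num), one_div]
    simp only [hfdef, hexp]
    push_cast
    ring
  have hlim := (hsum.sub (intervalIntegral_tendsto_integral_Ioi 0 (hI (p + 1))
    tendsto_natCast_atTop_atTop)).abs
  rw [integral_pow_mul_exp_neg hLpos] at hlim
  have hlimg := intervalIntegral_tendsto_integral_Ioi 0 hgI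
    (tendsto_natCast_atTop_atTop (R := ℝ))
  rw [hgint] at hlimg
  exact le_of_tendsto_of_tendsto' hlim hlimg (abs_sum_sub_integral_le hf hf'c hgc hfg)

open Filter in
lemma tendsto_preorderSeries_div :
    Tendsto (fun k : ℕ => preorderSeries k / (k.factorial / (2 * Real.log 2 ^ (k + 1))))
      atTop (nhds 1) := by
  have hLpos : 0 < Real.log 2 := Real.log_pos (by norm_num)
  rw [← tendsto_add_atTop_iff_nat 1, tendsto_iff_norm_sub_tendsto_zero]
  have hz : Tendsto (fun p : ℕ => Real.log 2 / √((p : ℝ) + 1)) atTop (nhds 0) := by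
    refine Tendsto.const_div_atTop ?_ _
    exact Real.tendsto_sqrt_atTop.comp (tendsto_atTop_add_const_right _ _
      tendsto_natCast_atTop_atTop)
  refine squeeze_zero (fun _ => norm_nonneg _) (fun p => ?_) hz
  have hs : √((p : ℝ) + 1) ^ 2 = p + 1 := Real.sq_sqrt (by positivity)
  have hspos : 0 < √((p : ℝ) + 1) := Real.sqrt_pos.mpr (by positivity)
  have hD : (0 : ℝ) < (p + 1).factorial / Real.log 2 ^ (p + 2) := by positivity
  have h := div_le_div_of_nonneg_right (abs_two_mul_preorderSeries_sub_le p) hD.le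
  rw [← abs_of_pos hD, ← abs_div, abs_of_pos hD] at h
  rw [Real.norm_eq_abs]
  refine le_of_eq_of_le (congrArg _ ?_) (h.trans_eq ?_)
  · field_simp
  · rw [Nat.factorial_succ]
    push_cast
    field_simp
    rw [hs]
    ring

lemma le_numOnes_of_isIncidence {k l : ℕ} {M : Matrix (Fin k) (Fin l) Bool} (h : IsIncidence M) :
    k ≤ numOnes M ∧ l ≤ numOnes M := by
  classical
  constructor
  · have : (Finset.univ : Finset (Fin k)) ⊆
        (Finset.univ.filter fun p : Fin k × Fin l => M p.1 p.2 = true).image Prod.fst := by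
      intro i _
      obtain ⟨j, hj⟩ := h.1 i
      exact Finset.mem_image.mpr ⟨(i, j), by simp [hj], rfl⟩
    simpa [numOnes] using (Finset.card_le_card this).trans Finset.card_image_le
  · have : (Finset.univ : Finset (Fin l)) ⊆
        (Finset.univ.filter fun p : Fin k × Fin l => M p.1 p.2 = true).image Prod.snd := by
      intro j _
      obtain ⟨i, hi⟩ := h.2 j
      exact Finset.mem_image.mpr ⟨(i, j), by simp [hi], rfl⟩
    simpa [numOnes] using (Finset.card_le_card this).trans Finset.card_image_le

lemma mIJ_eq_zero {i j n : ℕ} (h : n < i ∨ n < j) : mIJ i j n = 0 := by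
  have : IsEmpty {M : Matrix (Fin i) (Fin j) Bool // IsIncidence M ∧ numOnes M = n} := by
    refine ⟨fun M => ?_⟩
    have h1 := le_numOnes_of_isIncidence M.2.1
    have h2 := M.2.2
    lia
  exact Nat.card_of_isEmpty

lemma F1111_eq_sum (n : ℕ) :
    F1111 n = ∑ i ∈ Finset.range (n + 1), ∑ j ∈ Finset.range (n + 1), mIJ i j n := by
  let e : {A : Σ k l : ℕ, Matrix (Fin k) (Fin l) Bool // IsIncidence A.2.2 ∧ numOnes A.2.2 = n} ≃
      Σ k : Fin (n + 1), Σ l : Fin (n + 1),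
        {M : Matrix (Fin k) (Fin l) Bool // IsIncidence M ∧ numOnes M = n} :=
    { toFun := fun A =>
        ⟨⟨A.1.1, Nat.lt_succ_of_le ((le_numOnes_of_isIncidence A.2.1).1.trans_eq A.2.2)⟩,
          ⟨A.1.2.1, Nat.lt_succ_of_le ((le_numOnes_of_isIncidence A.2.1).2.trans_eq A.2.2)⟩,
          ⟨A.1.2.2, A.2⟩⟩
      invFun := fun B => ⟨⟨B.1, B.2.1, B.2.2.1⟩, B.2.2.2⟩
      left_inv := fun _ => rfl
      right_inv := fun _ => rfl }
  rw [F1111, Nat.card_congr e, Nat.card_sigma, Finset.sum_range]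
  refine Finset.sum_congr rfl fun i _ => ?_
  rw [Nat.card_sigma, Finset.sum_range]
  rfl

/-- The `n`-element subsets of `A ×ˢ B` projecting onto both factors are counted by the incidence
matrices of size `A.card × B.card`. -/
lemma card_filter_image_eq_mIJ {α β : Type*} [Fintype α] [Fintype β] [DecidableEq α]
    [DecidableEq β] (A : Finset α) (B : Finset β) (n : ℕ) :
    (Finset.univ.filter fun S : Finset (α × β) =>
      S.card = n ∧ S.image Prod.fst = A ∧ S.image Prod.snd = B).card = mIJ A.card B.card n := by
  rw [← Fintype.card_coe, ← Nat.card_eq_fintype_card, mIJ]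
  let a := A.equivFin
  let b := B.equivFin
  let emb : Fin A.card × Fin B.card ↪ α × β :=
    ⟨fun p => (a.symm p.1, b.symm p.2), fun p q h => by
      simp only [Prod.mk.injEq, Subtype.coe_inj, EmbeddingLike.apply_eq_iff_eq] at h
      exact Prod.ext h.1 h.2⟩
  have hemb : ∀ i j, emb (i, j) = ((a.symm i : α), (b.symm j : β)) := fun _ _ => rfl
  symm
  refine Nat.card_congr (Equiv.ofBijective (fun M =>
    ⟨(Finset.univ.filter fun p : Fin A.card × Fin B.card => M.1 p.1 p.2 = true).map emb, ?_⟩)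
    ⟨?_, ?_⟩)
  · simp only [Finset.mem_filter, Finset.mem_univ, true_and, Finset.card_map]
    refine ⟨M.2.2, ?_, ?_⟩
    · ext x
      simp only [Finset.mem_image, Finset.mem_map, Finset.mem_filter, Finset.mem_univ, true_and]
      constructor
      · rintro ⟨_, ⟨p, _, rfl⟩, rfl⟩
        exact (a.symm p.1).2
      · intro hx
        obtain ⟨j, hj⟩ := M.2.1.1 (a ⟨x, hx⟩)
        exact ⟨_, ⟨(a ⟨x, hx⟩, j), hj, rfl⟩, by simp [hemb]⟩
    · ext x
      simp only [Finset.mem_image, Finset.mem_map, Finset.mem_filter, Finset.mem_univ, true_and]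
      constructor
      · rintro ⟨_, ⟨p, _, rfl⟩, rfl⟩
        exact (b.symm p.2).2
      · intro hx
        obtain ⟨i, hi⟩ := M.2.1.2 (b ⟨x, hx⟩)
        exact ⟨_, ⟨(i, b ⟨x, hx⟩), hi, rfl⟩, by simp [hemb]⟩
  · intro M N h
    have h' := Finset.map_injective emb (congrArg Subtype.val h)
    refine Subtype.ext (funext fun i => funext fun j => ?_)
    have := Finset.ext_iff.mp h' (i, j)
    simp only [Finset.mem_filter, Finset.mem_univ, true_and] at this
    exact Bool.eq_iff_iff.mpr this
  · rintro ⟨S, hS⟩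
    simp only [Finset.mem_filter, Finset.mem_univ, true_and] at hS
    obtain ⟨hn, hA, hB⟩ := hS
    let M : Matrix (Fin A.card) (Fin B.card) Bool := fun i j => decide (emb (i, j) ∈ S)
    have hmap : (Finset.univ.filter fun p : Fin A.card × Fin B.card => M p.1 p.2 = true).map emb
        = S := by
      ext x
      simp only [Finset.mem_map, Finset.mem_filter, Finset.mem_univ, true_and, M,
        decide_eq_true_eq]
      constructor
      · rintro ⟨p, hp, rfl⟩
        exact hp
      · intro hx
        have hxA : x.1 ∈ A := hA ▸ Finset.mem_image_of_mem _ hx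
        have hxB : x.2 ∈ B := hB ▸ Finset.mem_image_of_mem _ hx
        have : emb (a ⟨x.1, hxA⟩, b ⟨x.2, hxB⟩) = x := by simp [hemb]
        exact ⟨(a ⟨x.1, hxA⟩, b ⟨x.2, hxB⟩), by rwa [this], this⟩
    refine ⟨⟨M, ⟨fun i => ?_, fun j => ?_⟩, ?_⟩, Subtype.ext hmap⟩
    · have hi : (a.symm i : α) ∈ S.image Prod.fst := by rw [hA]; exact (a.symm i).2
      obtain ⟨x, hx, hxi⟩ := Finset.mem_image.mp hi
      rw [← hmap] at hx
      obtain ⟨p, hp, rfl⟩ := Finset.mem_map.mp hx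
      have hpi : p.1 = i := a.symm.injective (Subtype.ext hxi)
      exact ⟨p.2, by simpa [hpi] using hp⟩
    · have hj : (b.symm j : β) ∈ S.image Prod.snd := by rw [hB]; exact (b.symm j).2
      obtain ⟨x, hx, hxj⟩ := Finset.mem_image.mp hj
      rw [← hmap] at hx
      obtain ⟨p, hp, rfl⟩ := Finset.mem_map.mp hx
      have hpj : p.2 = j := b.symm.injective (Subtype.ext hxj)
      exact ⟨p.1, by simpa [hpj] using hp⟩
    · exact (Finset.card_map emb).symm.trans ((congrArg Finset.card hmap).trans hn)

lemma sum_choose_mul_eq_of_eq_zero {f : ℕ → ℕ} {n : ℕ} (hf : ∀ i, n < i → f i = 0) (k : ℕ) :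
    ∑ i ∈ Finset.range (k + 1), k.choose i * f i =
      ∑ i ∈ Finset.range (n + 1), k.choose i * f i := by
  rw [Finset.sum_subset (Finset.range_mono (Nat.succ_le_succ (Nat.le_add_right k n))),
    Finset.sum_subset (Finset.range_mono (Nat.succ_le_succ (Nat.le_add_left n k)))]
  · intro i _ hi
    rw [hf i (by simpa using hi), mul_zero]
  · intro i _ hi
    rw [Nat.choose_eq_zero_of_lt (by simpa using hi), zero_mul]

lemma choose_mul_eq_sum (k l n : ℕ) :
    (k * l).choose n = ∑ i ∈ Finset.range (n + 1), ∑ j ∈ Finset.range (n + 1),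
      k.choose i * (l.choose j * mIJ i j n) := by
  have h1 : (k * l).choose n =
      ∑ A : Finset (Fin k), ∑ B : Finset (Fin l), mIJ A.card B.card n := by
    have hcard : (Finset.powersetCard n (Finset.univ : Finset (Fin k × Fin l))).card =
        (k * l).choose n := by simp
    rw [← hcard, Finset.card_eq_sum_card_fiberwise
      (f := fun S : Finset (Fin k × Fin l) => (S.image Prod.fst, S.image Prod.snd))
      (t := Finset.univ) (fun _ _ => by simp), ← Finset.univ_product_univ, Finset.sum_product]
    refine Finset.sum_congr rfl fun A _ => Finset.sum_congr rfl fun B _ => ?_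
    rw [← card_filter_image_eq_mIJ A B n]
    congr 1
    ext S
    simp [Finset.mem_powersetCard, Prod.ext_iff]
  have h2 : ∀ (m : ℕ) (f : ℕ → ℕ), (∀ i, n < i → f i = 0) →
      ∑ A : Finset (Fin m), f A.card = ∑ i ∈ Finset.range (n + 1), m.choose i * f i := by
    intro m f hf
    rw [← Finset.powerset_univ, Finset.sum_powerset_apply_card, Finset.card_univ, Fintype.card_fin]
    simpa using sum_choose_mul_eq_of_eq_zero hf m
  rw [h1, Finset.sum_congr rfl fun A _ => h2 l (fun j => mIJ A.card j n)
      fun j hj => mIJ_eq_zero (Or.inr hj),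
    h2 k (fun i => ∑ j ∈ Finset.range (n + 1), l.choose j * mIJ i j n)
      fun i hi => Finset.sum_eq_zero fun j _ => by rw [mIJ_eq_zero (Or.inl hi), mul_zero]]
  simp only [Finset.mul_sum]

lemma hasSum_choose_mul_half_pow (i : ℕ) :
    HasSum (fun k : ℕ => (k.choose i : ℝ) * (1 / 2) ^ (k + 1)) 1 := by
  have h := (hasSum_choose_mul_geometric_of_norm_lt_one i (r := (1 / 2 : ℝ))
    (by norm_num)).mul_right ((1 / 2) ^ (i + 1))
  rw [← hasSum_nat_add_iff' i, Finset.sum_eq_zero fun j hj => by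
    rw [Nat.choose_eq_zero_of_lt (Finset.mem_range.mp hj), Nat.cast_zero, zero_mul], sub_zero]
  convert! h using 1
  · ext k
    ring
  · norm_num

lemma hasSum_descFactorial_mul (k n : ℕ) :
    HasSum (fun l : ℕ => ((k * l).descFactorial n : ℝ) * (1 / 2) ^ (l + 1))
      (∑ j ∈ Finset.range (n + 1),
        (-1) ^ j * (fallingCoeff n j : ℝ) * (k : ℝ) ^ (n - j) * preorderSeries (n - j)) := by
  have h := hasSum_sum (s := Finset.range (n + 1)) fun j _ =>
    (hasSum_preorderSeries (n - j)).mul_left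
      ((-1) ^ j * (fallingCoeff n j : ℝ) * (k : ℝ) ^ (n - j))
  convert! h using 1
  ext l
  rw [descFactorial_eq_sum_fallingCoeff, Finset.sum_mul]
  refine Finset.sum_congr rfl fun j _ => ?_
  push_cast
  ring

lemma sum_choose_mul_mIJ_eq (k n : ℕ) :
    (n.factorial : ℝ) * ∑ i ∈ Finset.range (n + 1), ∑ j ∈ Finset.range (n + 1),
        (k.choose i : ℝ) * mIJ i j n =
      ∑ j ∈ Finset.range (n + 1),
        (-1) ^ j * (fallingCoeff n j : ℝ) * (k : ℝ) ^ (n - j) * preorderSeries (n - j) := by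
  refine HasSum.unique ?_ (hasSum_descFactorial_mul k n)
  have h := (hasSum_sum (s := Finset.range (n + 1)) fun i _ =>
    hasSum_sum (s := Finset.range (n + 1)) fun j _ =>
      (hasSum_choose_mul_half_pow j).mul_left ((k.choose i : ℝ) * mIJ i j n)).mul_left
        (n.factorial : ℝ)
  simp only [mul_one] at h
  convert! h using 1
  ext l
  rw [Nat.descFactorial_eq_factorial_mul_choose, choose_mul_eq_sum]
  push_cast
  simp only [Finset.mul_sum, Finset.sum_mul]
  refine Finset.sum_congr rfl fun i _ => Finset.sum_congr rfl fun j _ => ?_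
  ring

lemma factorial_mul_F1111 (n : ℕ) :
    (n.factorial : ℝ) * F1111 n = ∑ j ∈ Finset.range (n + 1),
      (-1) ^ j * (fallingCoeff n j : ℝ) * preorderSeries (n - j) ^ 2 := by
  have h1 := (hasSum_sum (s := Finset.range (n + 1)) fun i _ =>
    hasSum_sum (s := Finset.range (n + 1)) fun j _ =>
      (hasSum_choose_mul_half_pow i).mul_left (mIJ i j n : ℝ)).mul_left (n.factorial : ℝ)
  have h2 := hasSum_sum (s := Finset.range (n + 1)) fun j _ =>
    (hasSum_preorderSeries (n - j)).mul_left
      ((-1) ^ j * (fallingCoeff n j : ℝ) * preorderSeries (n - j))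
  rw [F1111_eq_sum]
  push_cast
  simp only [mul_one] at h1
  refine h1.unique ?_
  convert! h2 using 1
  · ext k
    have h := congrArg (· * (1 / 2 : ℝ) ^ (k + 1)) (sum_choose_mul_mIJ_eq k n)
    simp only [Finset.mul_sum, Finset.sum_mul] at h ⊢
    convert! h using 1
    · exact Finset.sum_congr rfl fun i _ => Finset.sum_congr rfl fun j _ => by ring
    · exact Finset.sum_congr rfl fun j _ => by ring
  · exact Finset.sum_congr rfl fun j _ => by ring

/-- The summand of index `j` in the expansion of `F₁₁₁₁ n / (n! / 4 * (log 2) ^ (-(2 * n + 2)))`. -/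
noncomputable def normalizedTerm (n j : ℕ) : ℝ :=
  (-1) ^ j * (fallingCoeff n j / (n.descFactorial j : ℝ) ^ 2) * Real.log 2 ^ (2 * j) *
    (preorderSeries (n - j) / ((n - j).factorial / (2 * Real.log 2 ^ (n - j + 1)))) ^ 2

lemma F1111_div_eq_tsum (n : ℕ) :
    (F1111 n : ℝ) / (n.factorial / 4 * (1 / Real.log 2) ^ (2 * n + 2)) =
      ∑' j, normalizedTerm n j := by
  have hLpos : 0 < Real.log 2 := Real.log_pos (by norm_num)
  have hfac : (0 : ℝ) < n.factorial := by positivity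
  rw [tsum_eq_sum (s := Finset.range (n + 1)) fun j hj => by
    rw [normalizedTerm, fallingCoeff_eq_zero (by simpa using hj)]; simp]
  have hF : (F1111 n : ℝ) = (∑ j ∈ Finset.range (n + 1),
      (-1) ^ j * (fallingCoeff n j : ℝ) * preorderSeries (n - j) ^ 2) / n.factorial := by
    rw [← factorial_mul_F1111]
    field_simp
  rw [hF, Finset.sum_div, Finset.sum_div]
  refine Finset.sum_congr rfl fun j hj => ?_
  have hjn : j ≤ n := Nat.lt_succ_iff.mp (Finset.mem_range.mp hj)
  obtain ⟨m, rfl⟩ := Nat.exists_eq_add_of_le hjn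
  have hfact : ((j + m).factorial : ℝ) = m.factorial * (j + m).descFactorial j := by
    have := Nat.factorial_mul_descFactorial hjn
    rw [Nat.add_sub_cancel_left] at this
    exact_mod_cast this.symm
  have hdpos : (0 : ℝ) < (j + m).descFactorial j := by
    exact_mod_cast Nat.descFactorial_pos.mpr hjn
  rw [normalizedTerm, Nat.add_sub_cancel_left, hfact, one_div, inv_pow]
  field_simp
  ring

lemma tendsto_normalizedTerm (j : ℕ) :
    Filter.Tendsto (fun n => normalizedTerm n j) Filter.atTop
      (nhds ((-(Real.log 2) ^ 2 / 2) ^ j / j.factorial)) := by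
  have hQ := (tendsto_preorderSeries_div.comp (Filter.tendsto_sub_atTop_nat j)).pow 2
  have h := (((tendsto_fallingCoeff_div_descFactorial_sq j).const_mul ((-1) ^ j)).mul_const
    (Real.log 2 ^ (2 * j))).mul hQ
  convert! h using 2
  rw [one_pow, mul_one, pow_mul, div_pow, neg_pow]
  field_simp

lemma exists_abs_normalizedTerm_le :
    ∃ C : ℝ, ∀ n j, |normalizedTerm n j| ≤
      C ^ 2 * ((Real.exp 1 ^ 2 * Real.log 2 ^ 2 / 2) ^ j / j.factorial) := by
  have hLpos : 0 < Real.log 2 := Real.log_pos (by norm_num)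
  obtain ⟨C, hC⟩ := tendsto_preorderSeries_div.abs.bddAbove_range
  refine ⟨C, fun n j => ?_⟩
  rcases lt_or_ge n j with hj | hj
  · rw [normalizedTerm, fallingCoeff_eq_zero hj]
    simp only [Nat.cast_zero, zero_div, mul_zero, zero_mul, abs_zero]
    positivity
  · have hdpos : (0 : ℝ) < n.descFactorial j := by exact_mod_cast Nat.descFactorial_pos.mpr hj
    have hcoeff : (fallingCoeff n j : ℝ) / (n.descFactorial j : ℝ) ^ 2 ≤
        Real.exp j ^ 2 / (2 ^ j * j.factorial) := by
      rw [div_le_iff₀ (by positivity)]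
      calc (fallingCoeff n j : ℝ) ≤ (n : ℝ) ^ (2 * j) / (2 ^ j * j.factorial) := fallingCoeff_le n j
        _ = ((n : ℝ) ^ j) ^ 2 / (2 ^ j * j.factorial) := by rw [← pow_mul, mul_comm j 2]
        _ ≤ (Real.exp j * n.descFactorial j) ^ 2 / (2 ^ j * j.factorial) := by
          gcongr
          exact pow_le_exp_mul_descFactorial hj
        _ = _ := by ring
    have hQ := hC (Set.mem_range_self (n - j))
    rw [normalizedTerm, abs_mul, abs_mul, abs_mul, abs_pow, abs_neg, abs_one, one_pow, one_mul,
      abs_pow _ 2, abs_of_nonneg (by positivity : (0 : ℝ) ≤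
        fallingCoeff n j / (n.descFactorial j : ℝ) ^ 2),
      abs_of_nonneg (by positivity : 0 ≤ Real.log 2 ^ (2 * j))]
    calc _ ≤ Real.exp j ^ 2 / (2 ^ j * j.factorial) * Real.log 2 ^ (2 * j) * C ^ 2 := by
          gcongr
      _ = _ := by
        rw [← mul_one (j : ℝ), Real.exp_nat_mul, pow_mul, div_pow, mul_pow, ← pow_mul, ← pow_mul,
          mul_comm j 2, pow_mul]
        field_simp

lemma tendsto_tsum_normalizedTerm :
    Filter.Tendsto (fun n => ∑' j, normalizedTerm n j) Filter.atTop
      (nhds (Real.exp (-(Real.log 2) ^ 2 / 2))) := by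
  obtain ⟨C, hC⟩ := exists_abs_normalizedTerm_le
  rw [Real.exp_eq_exp_ℝ, NormedSpace.exp_eq_tsum_div]
  exact tendsto_tsum_of_dominated_convergence ((Real.summable_pow_div_factorial _).mul_left (C ^ 2))
    tendsto_normalizedTerm (Filter.Eventually.of_forall hC)

/-- `F₁₁₁₁(n) ∼ (n!/4)·e^{-(log 2)²/2}·(log 2)^{-(2n+2)}` as `n → ∞`. -/
theorem F1111_asymptotics :
    Filter.Tendsto (fun n : ℕ =>
      (F1111 n : ℝ) /
        ((n.factorial : ℝ) / 4 * Real.exp (-(Real.log 2) ^ 2 / 2) *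
          (1 / Real.log 2) ^ (2 * n + 2)))
      Filter.atTop (nhds 1) := by
  have h := tendsto_tsum_normalizedTerm.div_const (Real.exp (-(Real.log 2) ^ 2 / 2))
  rw [div_self (Real.exp_pos _).ne'] at h
  refine h.congr fun n => ?_
  rw [← F1111_div_eq_tsum, div_div]
  congr 1
  ring
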